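/- arXiv:2603.27126 — 5 statements merged into one kernel-verified Lean document; each statement's English description precedes it below -/
import Mathlib

section
/- Let k ≥ 0 be an integer and let (b_1,…,b_s) be a k-Wahl chain. Set r = K(b_1,…,b_s) and a = K(b_2,…,b_s). Then r/(r−a−k) = [b_s,…,b_1]; that is, K(b_s,…,b_1) = r and K(b_{s−1},…,b_1) = r − a − k. -/
/-- The (negative/HJ) continuant: `contK [] = 1`, `contK [v] = v`,
`contK (v₁ :: v₂ :: rest) = v₁ * contK (v₂ :: rest) - contK rest`. -/
def contK : List ℤ → ℤ
  | [] => 1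
  | [v] => v
  | v :: w :: rest => v * contK (w :: rest) - contK rest

/-- `k`-Wahl chains: the smallest set of lists of integers containing `[k+2]`
and closed under `[b₁,…,bℓ] ↦ [b₁+1,b₂,…,bℓ,2]` and `[b₁,…,bℓ] ↦ [2,b₁,…,b_{ℓ-1},bℓ+1]`. -/
inductive IsKWahl (k : ℕ) : List ℤ → Prop
  | base : IsKWahl k [(k : ℤ) + 2]
  | right {b : ℤ} {t : List ℤ} : IsKWahl k (b :: t) → IsKWahl k ((b + 1) :: (t ++ [2]))
  | left {t : List ℤ} {b : ℤ} : IsKWahl k (t ++ [b]) → IsKWahl k (2 :: (t ++ [b + 1]))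

/-- Dual `k`-Wahl chains: the smallest set of lists of integers containing the list
of `k+1` twos and closed under the same two operations. -/
inductive IsDualKWahl (k : ℕ) : List ℤ → Prop
  | base : IsDualKWahl k (List.replicate (k + 1) 2)
  | right {b : ℤ} {t : List ℤ} : IsDualKWahl k (b :: t) → IsDualKWahl k ((b + 1) :: (t ++ [2]))
  | left {t : List ℤ} {b : ℤ} : IsDualKWahl k (t ++ [b]) → IsDualKWahl k (2 :: (t ++ [b + 1]))

/-- The remainder sequence: `rem l i = K(b_{i+1},…,b_s)` for `i ≤ s = l.length`
(so `rem l 0 = r`, `rem l 1 = a`, `rem l s = 1`), and `0` afterwards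
(so `rem l (s+1) = 0`). -/
def rem (l : List ℤ) (i : ℕ) : ℤ := if i ≤ l.length then contK (l.drop i) else 0

/-- Run-length encoding of a finite sequence: the lengths of its maximal blocks of
consecutive equal entries. -/
def rle : List ℤ → List ℕ
  | [] => []
  | [_] => [1]
  | a :: b :: t =>
    if a = b then
      match rle (b :: t) with
      | c :: cs => (c + 1) :: cs
      | [] => [1]
    else 1 :: rle (b :: t)

/-- The length encoding of special representations: the run-length encoding of the
difference sequence `(d₁,…,d_{s-1})` where `dᵢ = aᵢ - a_{i+1}`. -/
def LESR (l : List ℤ) : List ℕ :=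
  rle ((List.range (l.length - 1)).map fun i => rem l (i + 1) - rem l (i + 2))

/-- Add `c` to the first entry of a list. -/
def addHead (c : ℤ) : List ℤ → List ℤ
  | [] => []
  | a :: t => (a + c) :: t

/-- Add `c` to the last entry of a list. -/
def addLast (c : ℤ) : List ℤ → List ℤ
  | [] => []
  | [a] => [a + c]
  | a :: b :: t => a :: addLast c (b :: t)

/-- `(c₁,…,c_m)` is a length encoding of the `k`-Wahl chain `W`. -/
inductive IsLenEnc (k : ℕ) : List ℕ → List ℤ → Prop
  | base : IsLenEnc k [] [(k : ℤ) + 2]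
  | left {cs : List ℕ} {l : List ℤ} {c : ℕ} (hc : 0 < c)
      (h : IsLenEnc k cs l) (hhead : l.head? ≠ some 2) :
      IsLenEnc k (cs ++ [c]) (List.replicate c 2 ++ addLast (c : ℤ) l)
  | right {cs : List ℕ} {l : List ℤ} {c : ℕ} (hc : 0 < c)
      (h : IsLenEnc k cs l) (hlast : l.getLast? ≠ some 2) :
      IsLenEnc k (cs ++ [c]) (addHead (c : ℤ) l ++ List.replicate c 2)

/-- `kcf` is an admissible zero continued fraction for `b`: it has the same length,
`1 ≤ kᵢ ≤ bᵢ` entrywise, and its continuant vanishes. -/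
def IsAdmZCF (b kcf : List ℤ) : Prop :=
  List.Forall₂ (fun bi ki => 1 ≤ ki ∧ ki ≤ bi) b kcf ∧ contK kcf = 0

theorem contK_add_one_cons (v : ℤ) {t : List ℤ} (ht : t ≠ []) :
    contK ((v + 1) :: t) = contK (v :: t) + contK t := by
  obtain ⟨w, u, rfl⟩ := List.exists_cons_of_ne_nil ht
  simp only [contK]
  ring

theorem contK_append_pair (t : List ℤ) (x y : ℤ) :
    contK (t ++ [x, y]) = y * contK (t ++ [x]) - contK t := by
  induction t using contK.induct with
  | case1 => simp [contK]; ring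
  | case2 v => simp [contK]; ring
  | case3 v w u ih₁ ih₂ =>
    simp only [List.cons_append, contK] at *
    rw [ih₁, ih₂]
    ring

theorem contK_reverse (l : List ℤ) : contK l.reverse = contK l := by
  induction l using contK.induct with
  | case1 => rfl
  | case2 v => rfl
  | case3 v w u ih₁ ih₂ =>
    have h := contK_append_pair u.reverse w v
    simp only [List.reverse_cons, List.append_assoc, List.cons_append, List.nil_append] at *
    rw [h, ih₁, ih₂, contK]

theorem contK_append_add_one (v : ℤ) {t : List ℤ} (ht : t ≠ []) :
    contK (t ++ [v + 1]) = contK (t ++ [v]) + contK t := by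
  have h := contK_add_one_cons v (t := t.reverse) (by simpa using ht)
  rw [← contK_reverse (t ++ [v + 1]), ← contK_reverse (t ++ [v]), ← contK_reverse t]
  simpa using h

theorem IsKWahl.contK_sub_tail_sub_dropLast {k : ℕ} {b : List ℤ} (h : IsKWahl k b) :
    contK b - contK b.tail - contK b.dropLast = k := by
  induction h with
  | base =>
    simp [contK]
    ring
  | @right b t _ ih =>
    rcases List.eq_nil_or_concat' t with rfl | ⟨u, c, rfl⟩
    · simp [contK] at *
      linarith
    · have h₁ := contK_append_pair ((b + 1) :: u) c 2
      have h₂ := contK_append_pair u c 2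
      have h₃ := contK_add_one_cons b (t := u ++ [c]) (by simp)
      rcases eq_or_ne u [] with rfl | hu
      · simp [contK] at *
        linarith
      have h₄ := contK_add_one_cons b hu
      simp only [← List.cons_append, List.dropLast_concat] at ih ⊢
      simp only [List.tail_cons, List.cons_append, List.append_assoc, List.nil_append] at *
      linarith
  | @left t b _ ih =>
    cases t with
    | nil =>
      simp [contK] at *
      linarith
    | cons c u =>
      have h₁ := contK_append_add_one b (t := c :: u) (by simp)
      rcases eq_or_ne u [] with rfl | hu
      · simp [contK] at *
        linarith
      have h₂ := contK_append_add_one b hu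
      have h₃ : contK (2 :: (c :: u)) = 2 * contK (c :: u) - contK u := rfl
      have h₄ : contK (2 :: (c :: u ++ [b + 1])) =
        2 * contK (c :: u ++ [b + 1]) - contK (u ++ [b + 1]) := rfl
      have h₅ : (2 :: (c :: u ++ [b + 1])).dropLast = 2 :: c :: u :=
        List.dropLast_concat (l₁ := 2 :: c :: u)
      rw [h₅]
      rw [List.dropLast_concat] at ih
      simp only [List.tail_cons, List.cons_append] at *
      linarith

/-- If `(b₁,…,b_s)` is a `k`-Wahl chain with `r = K(b₁,…,b_s)` and `a = K(b₂,…,b_s)`,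
then `K(b_s,…,b₁) = r` and `K(b_{s-1},…,b₁) = r - a - k`. -/
theorem kWahl_reverse_continuant (k : ℕ) (b : List ℤ) (h : IsKWahl k b) :
    contK b.reverse = contK b ∧
    contK b.reverse.tail = contK b - contK b.tail - (k : ℤ) := by
  have hk := h.contK_sub_tail_sub_dropLast
  refine ⟨contK_reverse b, ?_⟩
  rw [List.tail_reverse, contK_reverse]
  linarith
end

section
/- Let k ≥ 0 be an integer and let (b_1,…,b_s) be a k-Wahl chain. Set r = K(b_1,…,b_s) and a = K(b_2,…,b_s). Then a·(r − a − k) ≡ 1 (mod r). -/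
/-- The product of the matrices `!![v, -1; 1, 0]` over the entries `v` of a list. Its entries are,
up to sign, the continuants of the list and of the lists without the first or last entry. -/
def contMat (l : List ℤ) : Matrix (Fin 2) (Fin 2) ℤ :=
  (l.map fun v => !![v, -1; 1, 0]).prod

theorem contMat_cons (v : ℤ) (l : List ℤ) :
    contMat (v :: l) = !![v, -1; 1, 0] * contMat l := by
  simp [contMat]

theorem contMat_append (l m : List ℤ) : contMat (l ++ m) = contMat l * contMat m := by
  simp [contMat]

theorem contMat_nil : contMat [] = 1 := by
  simp [contMat]

theorem det_contMat (l : List ℤ) : (contMat l).det = 1 := by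
  induction l with
  | nil => simp [contMat]
  | cons v l ih => rw [contMat_cons, Matrix.det_mul, ih]; simp

theorem contMat_cons_one (v : ℤ) (l : List ℤ) (j : Fin 2) :
    contMat (v :: l) 1 j = contMat l 0 j := by
  simp [contMat_cons, Matrix.mul_apply, Fin.sum_univ_two]

theorem contMat_zero_zero (l : List ℤ) : contMat l 0 0 = contK l := by
  induction l using contK.induct with
  | case1 => simp [contMat, contK]
  | case2 v => simp [contMat, contK]
  | case3 v w l ih₁ ih₂ =>
    have h : contMat (v :: w :: l) 0 0 = v * contMat (w :: l) 0 0 - contMat (w :: l) 1 0 := by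
      rw [contMat_cons v (w :: l)]
      simp [Matrix.mul_apply, Fin.sum_univ_two, sub_eq_add_neg]
    rw [h, contMat_cons_one, ih₁, ih₂, contK]

/-- In terms of continuants, a `k`-Wahl chain satisfies
`K(b₁,…,b_s) = K(b₂,…,b_s) + K(b₁,…,b_{s-1}) + k`. -/
theorem IsKWahl.contMat_zero_zero_eq {k : ℕ} {l : List ℤ} (h : IsKWahl k l) :
    contMat l 0 0 = contMat l 1 0 - contMat l 0 1 + k := by
  induction h with
  | base => simp [contMat_cons, contMat_nil]; ring
  | @right b t _ ih =>
    simp only [contMat_cons, contMat_append, contMat_nil, mul_one] at ih ⊢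
    simp only [Matrix.mul_apply,
      Fin.sum_univ_two, Matrix.of_apply, Matrix.cons_val_zero, Matrix.cons_val_one,
      Matrix.cons_val', Matrix.cons_val_fin_one] at ih ⊢
    linarith
  | @left t b _ ih =>
    simp only [contMat_cons, contMat_append, contMat_nil, mul_one] at ih ⊢
    simp only [Matrix.mul_apply,
      Fin.sum_univ_two, Matrix.of_apply, Matrix.cons_val_zero, Matrix.cons_val_one,
      Matrix.cons_val', Matrix.cons_val_fin_one] at ih ⊢
    linarith

theorem IsKWahl.ne_nil {k : ℕ} {l : List ℤ} (h : IsKWahl k l) : l ≠ [] := by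
  cases h <;> simp

/-- If `(b₁,…,b_s)` is a `k`-Wahl chain with `r = K(b₁,…,b_s)` and `a = K(b₂,…,b_s)`,
then `a·(r - a - k) ≡ 1 (mod r)`. -/
theorem kWahl_mod_inverse (k : ℕ) (b : List ℤ) (h : IsKWahl k b) :
    contK b.tail * (contK b - contK b.tail - (k : ℤ)) ≡ 1 [ZMOD contK b] := by
  obtain ⟨v, l, rfl⟩ := List.exists_cons_of_ne_nil h.ne_nil
  have hdet := det_contMat (v :: l)
  have hsum := h.contMat_zero_zero_eq
  rw [Matrix.det_fin_two] at hdet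
  rw [contMat_cons_one v l 0] at hdet hsum
  rw [List.tail_cons, ← contMat_zero_zero l, ← contMat_zero_zero (v :: l)]
  refine (Int.modEq_iff_dvd.mpr ⟨contMat (v :: l) 1 1, ?_⟩)
  linear_combination -hdet - contMat l 0 0 * hsum
end

section
/- Let (b_1,…,b_s) be a list of integers with every b_i ≥ 2. Then LESR(b_s,…,b_1) is the reversal of LESR(b_1,…,b_s): if LESR(b_1,…,b_s) = (c_1,…,c_m), then LESR(b_s,…,b_1) = (c_m,…,c_1). -/
/-- The run lengths of a nonempty sequence, read off from a list `m` whose entries equal to `2`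
mark the positions where two consecutive terms of the sequence agree. -/
def runLengths : List ℤ → List ℕ
  | [] => [1]
  | x :: m => if x = 2 then (runLengths m).modifyHead (· + 1) else 1 :: runLengths m

theorem runLengths_ne_nil (m : List ℤ) : runLengths m ≠ [] := by
  induction m with
  | nil => simp [runLengths]
  | cons x m ih => rw [runLengths]; split_ifs <;> simp [ih]

theorem modifyHead_reverse_comm {α : Type*} (f : α → α) (l : List α) :
    ((l.modifyHead f).reverse.modifyHead f).reverse =
      ((l.reverse.modifyHead f).reverse).modifyHead f := by
  rcases l with _ | ⟨a, t⟩
  · rfl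
  · rcases t.eq_nil_or_concat with rfl | ⟨t, b, rfl⟩ <;> simp

theorem runLengths_append_singleton (m : List ℤ) (x : ℤ) :
    runLengths (m ++ [x]) =
      if x = 2 then ((runLengths m).reverse.modifyHead (· + 1)).reverse
      else runLengths m ++ [1] := by
  induction m with
  | nil => simp [runLengths]
  | cons y m ih =>
    obtain ⟨c, cs, hc⟩ := List.exists_cons_of_ne_nil (runLengths_ne_nil m)
    rw [List.cons_append, runLengths, runLengths, ih]
    by_cases hx : x = 2 <;> by_cases hy : y = 2
    · simp only [hx, hy, if_true, modifyHead_reverse_comm]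
    · rcases cs.eq_nil_or_concat with rfl | ⟨t, b, rfl⟩ <;>
        simp [hx, hy, hc]
    · simp [hx, hy, hc]
    · simp [hx, hy]

theorem runLengths_reverse (m : List ℤ) : runLengths m.reverse = (runLengths m).reverse := by
  induction m with
  | nil => rfl
  | cons x m ih =>
    rw [List.reverse_cons, runLengths_append_singleton, ih, runLengths]
    split_ifs <;> simp

theorem contK_cons_gt (l : List ℤ) (hl : ∀ x ∈ l, 2 ≤ x) :
    0 < contK l ∧ ∀ v : ℤ, 2 ≤ v → contK l < contK (v :: l) := by
  induction l with
  | nil => exact ⟨by simp [contK], fun v hv => by simp only [contK]; omega⟩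
  | cons w t ih =>
    obtain ⟨hpos, hlt⟩ := ih fun x hx => hl x (List.mem_cons_of_mem _ hx)
    have hwt := hlt w (hl w List.mem_cons_self)
    refine ⟨hpos.trans hwt, fun v hv => ?_⟩
    rw [contK]
    nlinarith

theorem contK_pos (l : List ℤ) (hl : ∀ x ∈ l, 2 ≤ x) : 0 < contK l :=
  (contK_cons_gt l hl).1

/-- The differences of consecutive remainders, the sequence that `LESR` encodes. -/
def remDiffs (l : List ℤ) : List ℤ :=
  (List.range (l.length - 1)).map fun i => rem l (i + 1) - rem l (i + 2)

theorem rem_cons_succ (v : ℤ) (l : List ℤ) (i : ℕ) : rem (v :: l) (i + 1) = rem l i := by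
  simp [rem]

theorem remDiffs_cons_cons (v w : ℤ) (t : List ℤ) :
    remDiffs (v :: w :: t) = (contK (w :: t) - contK t) :: remDiffs (w :: t) := by
  simp only [remDiffs, List.length_cons, Nat.add_sub_cancel, List.range_succ_eq_map, List.map_cons,
    List.map_map, rem_cons_succ]
  simp [rem, Function.comp_def]

theorem rle_remDiffs (m : List ℤ) (v w : ℤ) (hm : ∀ x ∈ m, 2 ≤ x) (hw : 2 ≤ w) :
    rle (remDiffs (v :: (m ++ [w]))) = runLengths m := by
  induction m generalizing v with
  | nil => simp [remDiffs, runLengths, rle]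
  | cons x m ih =>
    have ih' := ih x fun y hy => hm y (List.mem_cons_of_mem _ hy)
    obtain ⟨u, t, ht⟩ := List.exists_cons_of_ne_nil (List.append_ne_nil_of_right_ne_nil m
      (List.cons_ne_nil w []))
    have hpos : 0 < contK (u :: t) := by
      rw [← ht]
      refine contK_pos _ fun y hy => ?_
      rcases List.mem_append.1 hy with h | h
      · exact hm y (List.mem_cons_of_mem _ h)
      · rwa [List.mem_singleton.1 h]
    have heq : contK (x :: u :: t) - contK (u :: t) = contK (u :: t) - contK t ↔ x = 2 := by
      rw [contK]
      constructor
      · intro h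
        exact mul_right_cancel₀ hpos.ne' (by linarith)
      · rintro rfl
        ring
    obtain ⟨c, cs, hc⟩ := List.exists_cons_of_ne_nil (runLengths_ne_nil m)
    rw [ht, remDiffs_cons_cons] at ih'
    rw [List.cons_append, ht, remDiffs_cons_cons, remDiffs_cons_cons, rle, ih', runLengths, hc]
    simp only [heq, List.modifyHead_cons]

theorem LESR_cons_append_singleton (m : List ℤ) (v w : ℤ) (hm : ∀ x ∈ m, 2 ≤ x) (hw : 2 ≤ w) :
    LESR (v :: (m ++ [w])) = runLengths m :=
  rle_remDiffs m v w hm hw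

/-- The LESR of the reversed continued fraction is the reversal of the LESR. -/
theorem LESR_reverse (b : List ℤ) (hb : ∀ x ∈ b, 2 ≤ x) :
    LESR b.reverse = (LESR b).reverse := by
  rcases b with _ | ⟨v, t⟩
  · rfl
  rcases t.eq_nil_or_concat with rfl | ⟨m, w, rfl⟩
  · rfl
  have hm : ∀ x ∈ m, 2 ≤ x := fun x hx => hb x (by simp [hx])
  have hrev : (v :: (m ++ [w])).reverse = w :: (m.reverse ++ [v]) := by simp
  rw [List.concat_eq_append, hrev, LESR_cons_append_singleton m v w hm (hb w (by simp)),
    LESR_cons_append_singleton m.reverse w v (fun x hx => hm x (List.mem_reverse.1 hx))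
      (hb v (by simp)), runLengths_reverse]
end

section
/- Let (b_1,…,b_s) be a list of integers with every b_i ≥ 2 and s ≥ 2, and suppose LESR(b_1,…,b_s) = (c_1,…,c_m) with m ≥ 1. Then: if b_s = 2, LESR(b_1,…,b_s,2) = (c_1,…,c_{m−1},c_m+1); and if b_s ≥ 3, LESR(b_1,…,b_s,2) = (c_1,…,c_m,1). -/
/-- The successive differences `K(t) - K(t.tail)` of the continuants of the suffixes of `t`. -/
def contKDiffs : List ℤ → List ℤ
  | [] => []
  | v :: t => (contK (v :: t) - contK t) :: contKDiffs t

theorem contKDiffs_eq_map (t : List ℤ) :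
    contKDiffs t =
      (List.range t.length).map fun i => contK (t.drop i) - contK (t.drop (i + 1)) := by
  induction t with
  | nil => rfl
  | cons v t ih => simp [contKDiffs, List.range_succ_eq_map, ih, Function.comp_def]

theorem LESR_cons (x : ℤ) (t : List ℤ) : LESR (x :: t) = rle (contKDiffs t) := by
  rw [LESR, contKDiffs_eq_map]
  congr 1
  refine List.map_congr_left fun i hi => ?_
  have hi : i < t.length := by simpa using hi
  simp [rem, hi, hi.le]

theorem contK_pos_and_lt_cons (t : List ℤ) (ht : ∀ x ∈ t, 2 ≤ x) :
    0 < contK t ∧ ∀ v, 2 ≤ v → contK t < contK (v :: t) := by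
  induction t with
  | nil => exact ⟨by simp [contK], fun v hv => by simp only [contK]; omega⟩
  | cons w t ih =>
    obtain ⟨hpos, hlt⟩ := ih fun x hx => ht x (by simp [hx])
    have hw := hlt w (ht w (by simp))
    refine ⟨by omega, fun v hv => ?_⟩
    simp only [contK]
    nlinarith

theorem rle_ne_nil (a : ℤ) (t : List ℤ) : rle (a :: t) ≠ [] := by
  cases t with
  | nil => simp [rle]
  | cons b t => rw [rle]; split_ifs <;> [split; skip] <;> simp

theorem rle_contKDiffs_two_cons (w : ℤ) (t : List ℤ) {c : ℕ} {cs : List ℕ}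
    (h : rle (contKDiffs (w :: t)) = c :: cs) :
    rle (contKDiffs (2 :: w :: t)) = (c + 1) :: cs := by
  have heq : contK (2 :: w :: t) - contK (w :: t) = contK (w :: t) - contK t := by
    simp only [contK]; ring
  simp only [contKDiffs] at h ⊢
  rw [rle, if_pos heq, h]

theorem rle_contKDiffs_cons_of_ne_two {v : ℤ} (hv : v ≠ 2) (w : ℤ) (t : List ℤ)
    (ht : ∀ x ∈ w :: t, 2 ≤ x) :
    rle (contKDiffs (v :: w :: t)) = 1 :: rle (contKDiffs (w :: t)) := by
  have hne : contK (v :: w :: t) - contK (w :: t) ≠ contK (w :: t) - contK t := by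
    intro h
    have hmul : (v - 2) * contK (w :: t) = 0 := by
      simp only [contK] at h; linarith
    rcases mul_eq_zero.mp hmul with h0 | h0
    · exact hv (by omega)
    · exact (contK_pos_and_lt_cons _ ht).1.ne' h0
  simp only [contKDiffs]
  rw [rle, if_neg hne]

theorem rle_contKDiffs_append_two (w : ℤ) (t : List ℤ) (ht : ∀ x ∈ w :: t, 2 ≤ x)
    (cs : List ℕ) (c : ℕ) (h : rle (contKDiffs (w :: t)) = cs ++ [c]) :
    rle (contKDiffs (w :: t ++ [2])) =
      if (w :: t).getLast? = some 2 then cs ++ [c + 1] else cs ++ [c, 1] := by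
  induction t generalizing w cs c with
  | nil =>
    have hcs : cs = [] ∧ c = 1 := by
      cases cs <;> simp_all [contKDiffs, rle]
    obtain ⟨rfl, rfl⟩ := hcs
    by_cases hw : w = 2
    · subst hw
      simpa using rle_contKDiffs_two_cons 2 [] (c := 1) (cs := []) rfl
    · simpa [hw, contKDiffs, rle] using rle_contKDiffs_cons_of_ne_two hw 2 [] (by simp)
  | cons u t ih =>
    have hu : ∀ x ∈ u :: t, 2 ≤ x := fun x hx => ht x (List.mem_cons_of_mem _ hx)
    have hu2 : ∀ x ∈ u :: (t ++ [2]), 2 ≤ x := by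
      intro x hx
      simp only [List.mem_cons, List.mem_append, List.not_mem_nil, or_false] at hx hu
      grind
    rw [List.getLast?_cons_cons]
    by_cases hw : w = 2
    · subst hw
      obtain ⟨d, ds, hd⟩ := List.exists_cons_of_ne_nil (rle_ne_nil _ (contKDiffs t) :
        rle (contKDiffs (u :: t)) ≠ [])
      rw [rle_contKDiffs_two_cons u t hd] at h
      cases cs with
      | nil =>
        obtain ⟨rfl, rfl⟩ : d + 1 = c ∧ ds = [] := by simpa using h
        have := ih u hu [] d hd
        simp only [List.nil_append, List.cons_append] at this ⊢
        split_ifs at this ⊢ <;> exact rle_contKDiffs_two_cons u (t ++ [2]) this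
      | cons e es =>
        obtain ⟨rfl, rfl⟩ : d + 1 = e ∧ ds = es ++ [c] := by simpa using h
        have := ih u hu (d :: es) c hd
        simp only [List.cons_append] at this ⊢
        split_ifs at this ⊢ <;> exact rle_contKDiffs_two_cons u (t ++ [2]) this
    · rw [rle_contKDiffs_cons_of_ne_two hw u t hu] at h
      have hcons := rle_contKDiffs_cons_of_ne_two hw u (t ++ [2]) hu2
      cases cs with
      | nil => exact absurd (List.cons.inj h).2 (rle_ne_nil _ _)
      | cons e es =>
        obtain ⟨rfl, hes⟩ := List.cons.inj h
        have := ih u hu es c hes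
        rw [List.cons_append] at this
        rw [List.cons_append, List.cons_append, hcons, this]
        split_ifs <;> rfl


/-- Appending a `2` to a continued fraction either increments the last block of the
LESR (if the last entry was `2`) or starts a new block of length `1` (if it was `≥ 3`). -/
theorem LESR_append_two (b : List ℤ) (hb : ∀ x ∈ b, 2 ≤ x) (hs : 2 ≤ b.length)
    (cs : List ℕ) (c : ℕ) (h : LESR b = cs ++ [c]) :
    (b.getLast? = some 2 → LESR (b ++ [2]) = cs ++ [c + 1]) ∧
    (∀ x, b.getLast? = some x → 3 ≤ x → LESR (b ++ [2]) = cs ++ [c, 1]) := by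
  match b, hs with
  | x :: w :: t, _ =>
    rw [LESR_cons] at h
    have key := rle_contKDiffs_append_two w t (fun y hy => hb y (List.mem_cons_of_mem _ hy)) cs c h
    rw [List.getLast?_cons_cons, List.cons_append, LESR_cons, key]
    refine ⟨fun h2 => if_pos h2, fun y hy hy3 => if_neg ?_⟩
    rw [hy, Option.some_inj]
    omega
end

section
/- Let (b_1,…,b_s) be a dual 1-Wahl chain with s ≥ 2. Then α(b_1,…,b_s) = 1: it admits an admissible zero continued fraction of weight 1, and admits none of weight 0. -/
/-- The product of the matrices `!![v, -1; 1, 0]` over the entries `v` of a list. -/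
def contMatrix : List ℤ → Matrix (Fin 2) (Fin 2) ℤ
  | [] => 1
  | v :: t => !![v, -1; 1, 0] * contMatrix t

theorem contMatrix_append (l r : List ℤ) :
    contMatrix (l ++ r) = contMatrix l * contMatrix r := by
  induction l with
  | nil => simp [contMatrix]
  | cons v t ih => rw [List.cons_append, contMatrix, contMatrix, ih, Matrix.mul_assoc]

theorem contMatrix_cons_zero (v : ℤ) (t : List ℤ) :
    contMatrix (v :: t) 0 0 = v * contMatrix t 0 0 - contMatrix t 1 0 := by
  simp [contMatrix, Matrix.mul_apply, Fin.sum_univ_two]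
  ring

theorem contMatrix_cons_one (v : ℤ) (t : List ℤ) :
    contMatrix (v :: t) 1 0 = contMatrix t 0 0 := by
  simp [contMatrix, Matrix.mul_apply, Fin.sum_univ_two]

theorem contK_eq_contMatrix (l : List ℤ) : contK l = contMatrix l 0 0 := by
  induction l using contK.induct with
  | case1 => simp [contK, contMatrix]
  | case2 v => simp [contK, contMatrix]
  | case3 v w t ih₁ ih₂ =>
    rw [contK, ih₁, ih₂, contMatrix_cons_zero v, contMatrix_cons_one w]

/-- Splitting off a reversed prefix of a continuant. -/
theorem contMatrix_reverse_append (l t : List ℤ) :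
    contMatrix (l.reverse ++ t) 0 0 =
      contMatrix l 0 0 * contMatrix t 0 0 - contMatrix l 1 0 * contMatrix t 1 0 := by
  induction l generalizing t with
  | nil => simp [contMatrix]
  | cons v l ih =>
    rw [List.reverse_cons, List.append_assoc, List.singleton_append, ih]
    simp only [contMatrix_cons_zero, contMatrix_cons_one]
    ring

theorem contMatrix_bounds {l : List ℤ} (hl : ∀ x ∈ l, 2 ≤ x) :
    0 ≤ contMatrix l 1 0 ∧ contMatrix l 1 0 < contMatrix l 0 0 := by
  induction l with
  | nil => simp [contMatrix]
  | cons v t ih =>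
    obtain ⟨h₀, h₁⟩ := ih fun x hx => hl x (List.mem_cons_of_mem _ hx)
    have hv := hl v List.mem_cons_self
    rw [contMatrix_cons_zero, contMatrix_cons_one]
    constructor
    · linarith
    · nlinarith

theorem eq_nil_of_contMatrix_eq_zero {l : List ℤ} (hl : ∀ x ∈ l, 2 ≤ x)
    (h : contMatrix l 1 0 = 0) : l = [] := by
  cases l with
  | nil => rfl
  | cons v t =>
    have := contMatrix_bounds fun x hx => hl x (List.mem_cons_of_mem v hx)
    rw [contMatrix_cons_one] at h
    omega

/-- If `l` and `r` are dual chains with entries at least `2`, then the sum of all entries is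
three times the total length minus two. -/
theorem sum_add_sum_of_dual (n : ℕ) (l r : List ℤ) (hn : l.length + r.length = n)
    (hl : ∀ x ∈ l, 2 ≤ x) (hr : ∀ x ∈ r, 2 ≤ x)
    (h : (contMatrix l 0 0 - contMatrix l 1 0) * (contMatrix r 0 0 - contMatrix r 1 0) =
      contMatrix l 1 0 * contMatrix r 1 0) :
    l.sum + r.sum = 3 * (n : ℤ) - 2 := by
  induction n generalizing l r with
  | zero =>
    obtain ⟨rfl, rfl⟩ : l = [] ∧ r = [] := by
      constructor <;> apply List.length_eq_zero_iff.mp <;> omega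
    simp [contMatrix] at h
  | succ n ih =>
    obtain _ | ⟨a, l⟩ := l
    · have := contMatrix_bounds hr
      simp [contMatrix.eq_1] at h
      omega
    obtain _ | ⟨c, r⟩ := r
    · have := contMatrix_bounds hl
      simp [contMatrix.eq_1] at h
      omega
    simp only [List.forall_mem_cons] at hl hr
    obtain ⟨ha, hl⟩ := hl
    obtain ⟨hc, hr⟩ := hr
    obtain ⟨p₀, p₁⟩ := contMatrix_bounds hl
    obtain ⟨q₀, q₁⟩ := contMatrix_bounds hr
    simp only [List.length_cons] at hn
    simp only [contMatrix_cons_zero, contMatrix_cons_one] at h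
    simp only [List.sum_cons]
    rcases ha.eq_or_lt with rfl | ha
    · rcases hc.eq_or_lt with rfl | hc
      · have hp : contMatrix l 1 0 = 0 := by
          by_contra hne
          have : 0 < contMatrix l 1 0 := by omega
          nlinarith [mul_pos this (sub_pos.mpr q₁), mul_nonneg (p₀.trans p₁.le) q₀]
        have hq : contMatrix r 1 0 = 0 := by
          by_contra hne
          have : 0 < contMatrix r 1 0 := by omega
          nlinarith [mul_pos this (sub_pos.mpr p₁), mul_nonneg (q₀.trans q₁.le) p₀]
        obtain rfl := eq_nil_of_contMatrix_eq_zero hl hp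
        obtain rfl := eq_nil_of_contMatrix_eq_zero hr hq
        obtain rfl : n = 1 := by simp at hn; omega
        simp
      · have := ih l ((c - 1) :: r) (by simp; omega) hl
          (by simpa using ⟨by omega, hr⟩)
          (by simp only [contMatrix_cons_zero, contMatrix_cons_one]; linear_combination h)
        simp only [List.sum_cons] at this
        push_cast
        linarith
    · rcases hc.eq_or_lt with rfl | hc
      · have := ih ((a - 1) :: l) r (by simp; omega)
          (by simpa using ⟨by omega, hl⟩) hr
          (by simp only [contMatrix_cons_zero, contMatrix_cons_one]; linear_combination h)
        simp only [List.sum_cons] at this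
        push_cast
        linarith
      · exfalso
        have hp : contMatrix l 0 0 < a * contMatrix l 0 0 - contMatrix l 1 0 - contMatrix l 0 0 := by
          nlinarith
        have hq : contMatrix r 0 0 < c * contMatrix r 0 0 - contMatrix r 1 0 - contMatrix r 0 0 := by
          nlinarith
        exact (mul_lt_mul'' hp hq (by omega) (by omega)).ne' h

theorem IsDualKWahl.two_le {k : ℕ} {b : List ℤ} (h : IsDualKWahl k b) : ∀ x ∈ b, 2 ≤ x := by
  induction h with
  | base => intro x hx; exact (List.eq_of_mem_replicate hx).ge
  | @right b t _ ih =>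
    have := ih b (by simp)
    grind
  | @left t b _ ih =>
    have := ih b (by simp)
    grind

theorem IsDualKWahl.sum_eq {b : List ℤ} (h : IsDualKWahl 1 b) :
    b.sum = 3 * (b.length : ℤ) - 2 := by
  induction h with
  | base => simp
  | right _ ih => simp at ih ⊢; linarith
  | left _ ih => simp at ih ⊢; linarith

theorem contMatrix_cons_add_one (v : ℤ) (t : List ℤ) :
    contMatrix ((v + 1) :: t) = !![1, 1; 0, 1] * contMatrix (v :: t) := by
  rw [contMatrix, contMatrix, ← Matrix.mul_assoc]
  congr 1
  simp

theorem contMatrix_append_add_one (t : List ℤ) (v : ℤ) :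
    contMatrix (t ++ [v + 1]) = contMatrix (t ++ [v]) * !![1, 0; -1, 1] := by
  rw [contMatrix_append, contMatrix_append, Matrix.mul_assoc]
  congr 1
  simp [contMatrix]

theorem forall₂_append_singleton_left {α β : Type*} {R : α → β → Prop} {t : List α} {b : α}
    {k : List β} (h : List.Forall₂ R (t ++ [b]) k) :
    ∃ t' b', k = t' ++ [b'] ∧ List.Forall₂ R t t' ∧ R b b' := by
  induction t generalizing k with
  | nil =>
    obtain _ | ⟨hb, hn⟩ := h
    cases hn
    exact ⟨[], _, rfl, .nil, hb⟩
  | cons a t ih =>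
    obtain _ | ⟨ha, ht⟩ := h
    obtain ⟨t', b', rfl, h₁, h₂⟩ := ih ht
    exact ⟨_ :: t', b', rfl, .cons ha h₁, h₂⟩

/-- A dual `1`-Wahl chain dominates a chain of total deficit two whose matrix is that of
`[1, 1]`. -/
theorem IsDualKWahl.exists_contMatrix_eq {b : List ℤ} (h : IsDualKWahl 1 b) :
    ∃ k, List.Forall₂ (fun bi ki => 1 ≤ ki ∧ ki ≤ bi) b k ∧
      contMatrix k = !![0, -1; 1, -1] ∧ b.sum - k.sum = 2 := by
  induction h with
  | base =>
    refine ⟨[1, 1], ?_, ?_, ?_⟩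
    · simp [List.replicate]
    · simp [contMatrix]
    · simp
  | right _ ih =>
    obtain ⟨k, hk, hM, hs⟩ := ih
    obtain _ | ⟨hv, ht⟩ := hk
    rename_i v t
    refine ⟨(v + 1) :: (t ++ [2]), .cons (by omega) (List.rel_append ht (by simp)), ?_, ?_⟩
    · rw [contMatrix_cons_add_one, ← List.cons_append, contMatrix_append, hM]
      simp [contMatrix]
    · simp at hs ⊢
      linarith
  | left _ ih =>
    obtain ⟨k, hk, hM, hs⟩ := ih
    obtain ⟨t, v, rfl, ht, hv⟩ := forall₂_append_singleton_left hk
    refine ⟨2 :: (t ++ [v + 1]),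
      .cons (by norm_num) (List.rel_append ht (.cons (by omega) .nil)), ?_, ?_⟩
    · rw [contMatrix, contMatrix_append_add_one, hM]
      simp
    · simp at hs ⊢
      linarith

theorem sum_le_sum_of_admissible {b k : List ℤ}
    (h : List.Forall₂ (fun bi ki => 1 ≤ ki ∧ ki ≤ bi) b k) : k.sum ≤ b.sum := by
  induction h with
  | nil => simp
  | cons h _ ih => simp only [List.sum_cons]; linarith [h.2]

theorem eq_of_admissible_of_sum_le {b k : List ℤ}
    (h : List.Forall₂ (fun bi ki => 1 ≤ ki ∧ ki ≤ bi) b k) (hs : b.sum ≤ k.sum) : b = k := by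
  induction h with
  | nil => rfl
  | cons h ht ih =>
    have := sum_le_sum_of_admissible ht
    simp only [List.sum_cons] at hs
    rw [ih (by linarith [h.2])]
    congr 1
    linarith [h.2]

theorem forall₂_append_cons_right {α β : Type*} {R : α → β → Prop} {l r : List β} {v : β}
    {b : List α} (h : List.Forall₂ R b (l ++ v :: r)) :
    ∃ l' v' r', b = l' ++ v' :: r' ∧ List.Forall₂ R l' l ∧ R v' v ∧ List.Forall₂ R r' r := by
  induction l generalizing b with
  | nil =>
    obtain _ | ⟨hv, hr⟩ := h
    exact ⟨[], _, _, rfl, .nil, hv, hr⟩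
  | cons a l ih =>
    obtain _ | ⟨ha, ht⟩ := h
    obtain ⟨l', v', r', rfl, h₁, h₂, h₃⟩ := ih ht
    exact ⟨_ :: l', v', r', rfl, .cons ha h₁, h₂, h₃⟩

theorem one_le_of_admissible {b k : List ℤ}
    (h : List.Forall₂ (fun bi ki => 1 ≤ ki ∧ ki ≤ bi) b k) : ∀ x ∈ k, 1 ≤ x := by
  induction h with
  | nil => simp
  | cons h _ ih => exact List.forall_mem_cons.mpr ⟨h.1, ih⟩

/-- Every admissible zero continued fraction of a dual `1`-Wahl chain has total deficit at
least two. -/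
theorem IsDualKWahl.two_le_sum_sub_sum {b k : List ℤ} (h : IsDualKWahl 1 b)
    (hk : IsAdmZCF b k) : 2 ≤ b.sum - k.sum := by
  obtain ⟨hbk, h_zero⟩ := hk
  rw [contK_eq_contMatrix] at h_zero
  by_contra! hlt
  have h_one : (1 : ℤ) ∈ k := by
    by_contra hmem
    have := contMatrix_bounds (l := k) fun x hx => by
      have := one_le_of_admissible hbk x hx
      have : x ≠ 1 := fun hx' => hmem (hx' ▸ hx)
      omega
    omega
  obtain ⟨l, r, rfl⟩ := List.append_of_mem h_one
  have hsum := h.sum_eq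
  have hb := h.two_le
  obtain ⟨l', v, r', rfl, hl, hv, hr⟩ := forall₂_append_cons_right hbk
  have hv2 : 2 ≤ v := hb v (by simp)
  have hls := sum_le_sum_of_admissible hl
  have hrs := sum_le_sum_of_admissible hr
  simp only [List.sum_append, List.sum_cons] at hlt
  obtain rfl := eq_of_admissible_of_sum_le hl (by linarith)
  obtain rfl := eq_of_admissible_of_sum_le hr (by linarith)
  have h_rev := contMatrix_reverse_append l'.reverse (1 :: r')
  rw [List.reverse_reverse, h_zero, contMatrix_cons_zero, contMatrix_cons_one] at h_rev
  have := sum_add_sum_of_dual _ l'.reverse r' rfl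
    (fun x hx => hb x (by simp [List.mem_reverse.mp hx])) (fun x hx => hb x (by simp [hx]))
    (by linear_combination -h_rev)
  simp at this hsum
  linarith

/-- For a dual `1`-Wahl chain of length `≥ 2`, the minimal weight of an admissible
zero continued fraction is `1`. -/
theorem alpha_dual_one_wahl (b : List ℤ) (h : IsDualKWahl 1 b) (hs : 2 ≤ b.length) :
    IsLeast {w : ℤ | ∃ kcf, IsAdmZCF b kcf ∧ w = b.sum - kcf.sum - 1} 1 := by
  constructor
  · obtain ⟨k, hk, hM, hsum⟩ := h.exists_contMatrix_eq
    refine ⟨k, ⟨hk, ?_⟩, by omega⟩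
    rw [contK_eq_contMatrix, hM]
    rfl
  · rintro w ⟨k, hk, rfl⟩
    have := h.two_le_sum_sub_sum hk
    omega
end
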